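/- For every k ≥ 3, the (2-color) Ramsey number of the cycle C_k is at most 2k. -/

import Mathlib

/-- `K_N` arrows `H` for 2-colorings: every 2-coloring of the edges of `K_N`
contains a monochromatic copy of `H`. -/
def GraphArrows (N : ℕ) {W : Type*} (H : SimpleGraph W) : Prop :=
  ∀ c : Fin N → Fin N → Bool, (∀ u v, c u v = c v u) →
    ∃ (f : W → Fin N) (col : Bool), Function.Injective f ∧
      ∀ a b, H.Adj a b → c (f a) (f b) = col

/-- The (2-color) Ramsey number of a graph `H`. -/
noncomputable def ramseyNumber {W : Type*} (H : SimpleGraph W) : ℕ :=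
  sInf {N : ℕ | GraphArrows N H}

section MonochromaticCycles

variable {V : Type*}

/-- `f : ℤ → V` runs periodically around a cycle with `m` vertices, all of whose edges have
colour `col`. -/
def IsMonoCycle (c : V → V → Bool) (col : Bool) (m : ℕ) (f : ℤ → V) : Prop :=
  (∀ i j, f i = f j ↔ (m : ℤ) ∣ i - j) ∧ ∀ i, c (f i) (f (i + 1)) = col

/-- The colouring `c` contains a cycle with `m` vertices, all of whose edges have colour `col`. -/
def HasMonoCycle (c : V → V → Bool) (col : Bool) (m : ℕ) : Prop :=
  ∃ f, IsMonoCycle c col m f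

theorem exists_periodic_extension {m : ℕ} (hm : 0 < m) (g : ℕ → V)
    (hg : ∀ i j, i < m → j < m → g i = g j → i = j) :
    ∃ f : ℤ → V, (∀ i j, f i = f j ↔ (m : ℤ) ∣ i - j) ∧ ∀ i : ℕ, i < m → f i = g i := by
  have hm' : (0 : ℤ) < m := by exact_mod_cast hm
  refine ⟨fun i => g (i % m).toNat, fun i j => ?_, fun i hi => ?_⟩
  · have h1 := Int.emod_nonneg i hm'.ne'
    have h2 := Int.emod_nonneg j hm'.ne'
    have h3 := Int.emod_lt_of_pos i hm'
    have h4 := Int.emod_lt_of_pos j hm'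
    have key : (m : ℤ) ∣ i - j ↔ i % m = j % m :=
      (Int.emod_eq_emod_iff_emod_sub_eq_zero.trans Int.dvd_iff_emod_eq_zero.symm).symm
    rw [key]
    constructor
    · intro h
      have := hg _ _ (by omega) (by omega) h
      omega
    · intro h
      simp only [h]
  · have : ((i : ℤ) % m) = i := Int.emod_eq_of_lt (by omega) (by omega)
    simp [this]

theorem exists_nat_rep {m : ℕ} (hm : 0 < m) (i : ℤ) :
    ∃ k : ℕ, k < m ∧ (m : ℤ) ∣ i - k := by
  have hm' : (0 : ℤ) < m := by exact_mod_cast hm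
  have h1 := Int.emod_nonneg i hm'.ne'
  have h3 := Int.emod_lt_of_pos i hm'
  refine ⟨(i % m).toNat, by omega, ?_⟩
  rw [Int.toNat_of_nonneg h1]
  exact Int.dvd_self_sub_emod

theorem hasMonoCycle_of_nat {c : V → V → Bool} {col : Bool} {m : ℕ} (hm : 0 < m) (g : ℕ → V)
    (hg : ∀ i j, i < m → j < m → g i = g j → i = j)
    (hc : ∀ i, i + 1 < m → c (g i) (g (i + 1)) = col)
    (hl : c (g (m - 1)) (g 0) = col) : HasMonoCycle c col m := by
  obtain ⟨f, hf, hfg⟩ := exists_periodic_extension hm g hg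
  refine ⟨f, hf, fun i => ?_⟩
  obtain ⟨k, hk, hd⟩ := exists_nat_rep hm i
  have e1 : f i = f k := (hf _ _).2 hd
  rw [e1, hfg k hk]
  by_cases h : k + 1 < m
  · have e2 : f (i + 1) = f ((k + 1 : ℕ) : ℤ) := (hf _ _).2 (by push_cast; simpa using hd)
    rw [e2, hfg _ h]
    exact hc k h
  · have e2 : f (i + 1) = f ((0 : ℕ) : ℤ) := by
      refine (hf _ _).2 ?_
      have : i + 1 - ((0 : ℕ) : ℤ) = (i - k) + m := by push_cast; omega
      rw [this]
      exact hd.add (dvd_refl _)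
    rw [e2, hfg 0 hm]
    have : k = m - 1 := by omega
    rw [this]; exact hl

theorem hasMonoCycle_of_index {c : V → V → Bool} {col : Bool} {m m' : ℕ} {f : ℤ → V}
    (hf : ∀ i j, f i = f j ↔ (m : ℤ) ∣ i - j) (hm : 0 < m') (s : ℕ → ℤ) (t : ℤ)
    (hs : ∀ i, i < m' → t ≤ s i ∧ s i < t + m)
    (hinj : ∀ i j, i < m' → j < m' → s i = s j → i = j)
    (hc : ∀ i, i + 1 < m' → c (f (s i)) (f (s (i + 1))) = col)
    (hl : c (f (s (m' - 1))) (f (s 0)) = col) : HasMonoCycle c col m' := by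
  refine hasMonoCycle_of_nat hm (fun i => f (s i)) (fun i j hi hj h => hinj i j hi hj ?_) hc hl
  have hd := (hf _ _).1 h
  have h1 := hs i hi
  have h2 := hs j hj
  have := Int.eq_zero_of_abs_lt_dvd hd (by rw [abs_lt]; constructor <;> omega)
  omega

namespace IsMonoCycle

theorem hasMonoCycle_pred {c : V → V → Bool} (hsymm : ∀ u v, c u v = c v u) {col : Bool} {m : ℕ}
    {f : ℤ → V} (h : IsMonoCycle c col m f) (i : ℤ) (a : ℕ) (ha : 1 ≤ a) (ham : a + 3 ≤ m)
    (h1 : c (f i) (f (i + a)) = col) (h2 : c (f (i + 1)) (f (i + a + 2)) = col) :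
    HasMonoCycle c col (m - 1) := by
  refine hasMonoCycle_of_index h.1 (by omega)
    (fun k => i + if k = 0 then 0 else if k ≤ a then (a : ℤ) + 1 - k else k + 1) i ?_ ?_ ?_ ?_
  · intro k hk; split_ifs <;> omega
  · intro k k' hk hk'; split_ifs <;> omega
  · intro k hk
    rcases Nat.eq_zero_or_pos k with rfl | hk0
    · rw [if_pos rfl, if_neg (by omega), if_pos (by omega)]
      simpa using h1
    have hk1 : k ≠ 0 := by omega
    simp only [hk1, if_false, Nat.succ_ne_zero]
    rcases lt_trichotomy k a with hka | hka | hka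
    · rw [if_pos (by omega), if_pos (by omega), hsymm]
      convert h.2 (i + (a + 1 - (k + 1 : ℕ))) using 3
      push_cast; ring
    · subst hka
      rw [if_pos le_rfl, if_neg (by omega)]
      convert h2 using 3
      · ring
      · push_cast; ring
    · rw [if_neg (by omega), if_neg (by omega)]
      convert h.2 (i + (k + 1)) using 3
      push_cast; ring
  · rw [if_neg (by omega), if_neg (by omega), if_pos rfl]
    convert h.2 (i + m - 1) using 2
    · congr 1; omega
    · rw [h.1]; ring_nf; simp

end IsMonoCycle

theorem dvd_two_mul_iff {l : ℕ} (x : ℤ) :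
    ((2 * l + 1 : ℕ) : ℤ) ∣ 2 * x ↔ ((2 * l + 1 : ℕ) : ℤ) ∣ x := by
  constructor
  · rintro ⟨q, hq⟩
    refine ⟨x - l * q, ?_⟩
    push_cast at *
    linear_combination -l * hq
  · exact fun h => h.mul_left 2

namespace IsMonoCycle

theorem exists_hasMonoCycle_of_odd {c : V → V → Bool} (hsymm : ∀ u v, c u v = c v u) {col : Bool}
    {l : ℕ} (hl : 3 ≤ l) {f : ℤ → V} (h : IsMonoCycle c col (2 * l + 1) f) :
    ∃ col', HasMonoCycle c col' (2 * l) := by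
  by_contra! hno
  have five : ∀ i, c (f i) (f (i + 4)) = col → c (f (i + 1)) (f (i + 6)) = !col := fun i h4 => by
    by_contra h5
    refine hno col (h.hasMonoCycle_pred hsymm i 4 (by omega) (by omega) h4 ?_)
    rw [add_assoc i]
    simpa using h5
  have three : ∀ i, c (f (i + 1)) (f (i + 5)) = col → c (f i) (f (i + 3)) = !col := fun i h4 => by
    by_contra h3
    refine hno col (h.hasMonoCycle_pred hsymm i 3 (by omega) (by omega) (by simpa using h3) ?_)
    rw [add_assoc i]
    exact h4
  have two : ∀ i, c (f i) (f (i + 2)) = !col := fun i => by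
    by_contra h2
    refine hno col (h.hasMonoCycle_pred hsymm (i - 1) 1 (by omega) (by omega) ?_ ?_)
    · exact_mod_cast h.2 (i - 1)
    · convert (by simpa using h2 : c (f i) (f (i + 2)) = col) using 3 <;>
        push_cast <;> ring
  have hu : ∀ t, IsMonoCycle c (!col) (2 * l + 1) (fun i => f (2 * i + t)) := by
    refine fun t => ⟨fun i j => ?_, fun i => ?_⟩
    · rw [h.1, ← dvd_two_mul_iff (i - j), show 2 * i + t - (2 * j + t) = 2 * (i - j) by ring]
    · convert two (2 * i + t) using 3; ring
  have four : ∀ i, c (f i) (f (i + 4)) = col := fun i => by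
    by_contra h4
    refine hno (!col) ((hu i).hasMonoCycle_pred hsymm (-1) 1 (by omega) (by omega) ?_ ?_)
    · exact_mod_cast (hu i).2 (-1)
    · convert (Bool.eq_not.2 h4 : c (f i) (f (i + 4)) = !col) using 3 <;> push_cast <;> ring
  refine hno (!col) ((hu 0).hasMonoCycle_pred hsymm 0 (l - 2) (by omega) (by omega) ?_ ?_)
  · rw [hsymm, ← five (-6) (four _)]
    congr 1
    · rw [h.1, Nat.cast_sub (by omega)]; push_cast; exact ⟨1, by ring⟩
  · rw [hsymm, ← three (-1) (four _)]
    congr 1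
    · rw [h.1, Nat.cast_sub (by omega)]; push_cast; exact ⟨1, by ring⟩

theorem even_chord {c : V → V → Bool} (hsymm : ∀ u v, c u v = c v u) {col : Bool}
    {l : ℕ} (hl : 3 ≤ l) {f : ℤ → V} (h : IsMonoCycle c col (2 * l) f)
    (hno : ∀ col', ¬ HasMonoCycle c col' (2 * l - 1)) (i : ℤ) (j : ℕ) (hj : 1 ≤ j) (hjl : j < l) :
    c (f i) (f (i + 2 * j)) = !col := by
  have two : ∀ i, c (f i) (f (i + 2)) = !col := fun i => by
    by_contra h2
    refine hno col (h.hasMonoCycle_pred hsymm (i - 1) 1 (by omega) (by omega) ?_ ?_)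
    · exact_mod_cast h.2 (i - 1)
    · convert (by simpa using h2 : c (f i) (f (i + 2)) = col) using 3 <;> push_cast <;> ring
  by_contra hcon
  have hcol : c (f i) (f (i + 2 * j)) = col := by simpa using hcon
  have hj1 : j ≠ 1 := by
    rintro rfl
    exact hcon (by simpa using two i)
  have hjl' : j ≠ l - 1 := by
    rintro rfl
    refine hcon ?_
    rw [hsymm, ← two (i + 2 * (l - 1 : ℕ)), (h.1 (i + 2 * (l - 1 : ℕ) + 2) i).2]
    rw [Nat.cast_sub (by omega)]; push_cast; exact ⟨1, by ring⟩
  have right : c (f (i + 1)) (f (i + 2 * j + 2)) = !col := by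
    by_contra hr
    refine hno col (h.hasMonoCycle_pred hsymm i (2 * j) (by omega) (by omega) ?_ ?_)
    · simpa using hcol
    · simpa using hr
  have left : c (f (i - 1)) (f (i + 2 * j - 2)) = !col := by
    by_contra hr
    have hr' : c (f (i - 1)) (f (i + 2 * j - 2)) = col := by simpa using hr
    refine hno col (h.hasMonoCycle_pred hsymm (i - 1) (2 * j - 1) (by omega) (by omega) ?_ ?_)
    · convert hr' using 3; omega
    · convert hcol using 3 <;> omega
  refine hno (!col) (hasMonoCycle_of_nat (by omega)
    (fun k => f (i + if k < l then (2 * k + 1 : ℤ) else 2 * j - 2 - 2 * (k - l))) ?_ ?_ ?_)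
  · intro a b ha hb hab
    have hd := (h.1 _ _).1 hab
    have h2 : (2 : ℤ) ∣ ((2 * l : ℕ) : ℤ) := ⟨l, by push_cast; ring⟩
    have h2 := h2.trans hd
    have : |i + (if a < l then (2 * a + 1 : ℤ) else 2 * j - 2 - 2 * (a - l)) -
        (i + if b < l then (2 * b + 1 : ℤ) else 2 * j - 2 - 2 * (b - l))| < ((2 * l : ℕ) : ℤ) →
        a = b := by
      intro hlt
      have := Int.eq_zero_of_abs_lt_dvd hd hlt
      split_ifs at this <;> omega
    split_ifs at this h2 <;> first | omega | (apply this; rw [abs_lt]; omega)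
  · intro k hk
    rcases lt_trichotomy (k + 1) l with hkl | hkl | hkl
    · rw [if_pos (by omega), if_pos (by omega)]
      convert two (i + (2 * k + 1)) using 3
      push_cast; ring
    · rw [if_pos (by omega), if_neg (by omega), ← left]
      congr 1
      · rw [h.1]; exact ⟨1, by push_cast; omega⟩
      · congr 1; omega
    · rw [if_neg (by omega), if_neg (by omega), hsymm]
      convert two (i + (2 * j - 2 - 2 * (↑(k + 1) - l))) using 3
      push_cast; ring
  · rw [if_neg (by omega), if_pos (by omega), hsymm, ← right]
    congr 1
    rw [h.1]; exact ⟨-1, by push_cast; omega⟩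

end IsMonoCycle

theorem hasMonoCycle_of_two_arcs {c : V → V → Bool} (hsymm : ∀ u v, c u v = c v u) {col : Bool}
    {n : ℕ} (hn : 3 ≤ n) {f : ℤ → V} (hf : ∀ i j, f i = f j ↔ ((2 * n : ℕ) : ℤ) ∣ i - j)
    {e : ℕ} (hne : n ≤ e) (he : e ≤ 2 * n)
    (h1 : ∀ i : ℤ, 0 ≤ i → i < e → c (f i) (f (i + 1)) = col)
    (h2 : ∀ i : ℤ, e ≤ i → i < (2 * n : ℕ) → c (f i) (f (i + 1)) = !col) :
    ∃ m col', n ≤ m ∧ HasMonoCycle c col' m := by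
  have hwrap : f ((2 * n : ℕ) : ℤ) = f 0 := (hf _ _).2 ⟨1, by push_cast; ring⟩
  rcases he.eq_or_lt with rfl | he
  · refine ⟨2 * n, col, by omega, hasMonoCycle_of_index hf (by omega) (fun k => k) 0 ?_ ?_ ?_ ?_⟩
    · intro i hi; omega
    · intro i j _ _ h; exact_mod_cast h
    · intro i hi
      have := h1 i (by omega) (by omega)
      exact_mod_cast this
    · have := h1 ((2 * n - 1 : ℕ) : ℤ) (by omega) (by omega)
      rw [← Nat.cast_add_one, Nat.sub_add_cancel (by omega), hwrap] at this
      exact_mod_cast this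
  by_cases hex : ∃ i j : ℤ, 0 ≤ i ∧ i + (n - 1) ≤ j ∧ j ≤ e ∧ c (f i) (f j) = col
  · obtain ⟨i, j, hi, hij, hje, hc⟩ := hex
    refine ⟨(j - i + 1).toNat, col, by omega,
      hasMonoCycle_of_index hf (by omega) (fun k => i + k) i ?_ ?_ ?_ ?_⟩
    · intro k hk; omega
    · intro k k' _ _ h; omega
    · intro k hk
      have := h1 (i + k) (by omega) (by omega)
      convert this using 3
      push_cast; ring
    · rw [hsymm]
      convert hc using 3 <;> omega
  · push Not at hex
    have hcross : ∀ i j : ℤ, 0 ≤ i → i + (n - 1) ≤ j → j ≤ e → c (f i) (f j) = !col :=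
      fun i j hi hij hj => Bool.eq_not.2 (hex i j hi hij hj)
    refine ⟨e + 1, !col, by omega, hasMonoCycle_of_index hf (by omega)
      (fun k => if k < 2 * (e - n + 1) then if k % 2 = 0 then ((k / 2 : ℕ) : ℤ)
        else ((n + k / 2 : ℕ) : ℤ) else ((k + 2 * n - e - 1 : ℕ) : ℤ)) 0 ?_ ?_ ?_ ?_⟩
    · intro k hk; split_ifs <;> omega
    · intro k k' hk hk'; split_ifs <;> omega
    · intro k hk
      rcases lt_trichotomy (k + 1) (2 * (e - n + 1)) with hk1 | hk1 | hk1
      · rw [if_pos (by omega), if_pos hk1]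
        rcases Nat.mod_two_eq_zero_or_one k with hk2 | hk2
        · rw [if_pos hk2, if_neg (by omega)]
          exact hcross _ _ (by omega) (by omega) (by omega)
        · rw [if_neg (by omega), if_pos (by omega), hsymm]
          exact hcross _ _ (by omega) (by omega) (by omega)
      · rw [if_pos (by omega), if_neg (by omega), if_neg (by omega)]
        convert h2 e le_rfl (by omega) using 3 <;> omega
      · rw [if_neg (by omega), if_neg (by omega)]
        convert h2 (k + 2 * n - e - 1 : ℕ) (by omega) (by omega) using 3
        omega
    · rw [Nat.add_sub_cancel, if_pos (show 0 < 2 * (e - n + 1) by omega), if_pos rfl]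
      by_cases hk : e < 2 * (e - n + 1)
      · rw [if_pos hk, if_neg (by omega), hsymm]
        exact hcross _ _ (by omega) (by omega) (by omega)
      · rw [if_neg hk]
        have := h2 (2 * n - 1 : ℕ) (by omega) (by omega)
        rw [← Nat.cast_add_one, Nat.sub_add_cancel (by omega), hwrap] at this
        convert this using 3 <;> omega

theorem exists_two_colored_path {c : V → V → Bool} (hsymm : ∀ u v, c u v = c v u)
    {S : Finset V} (hS : S.Nonempty) :
    ∃ (p : V) (A B : List V), (A.reverse ++ p :: B).Nodup ∧
      (∀ v, v ∈ A.reverse ++ p :: B ↔ v ∈ S) ∧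
      (p :: A).IsChain (fun u v => c u v = true) ∧ (p :: B).IsChain (fun u v => c u v = false) := by
  classical
  induction hS using Finset.Nonempty.cons_induction with
  | singleton a => exact ⟨a, [], [], by simp⟩
  | cons v S hv hS ih =>
    obtain ⟨p, A, B, hnd, hmem, hA, hB⟩ := ih
    have hv' := hv
    rw [← hmem] at hv'
    have hmem' : ∀ w, w ∈ Finset.cons v S hv ↔ w = v ∨ w ∈ A ∨ w = p ∨ w ∈ B := by
      intro w; rw [Finset.mem_cons, ← hmem]; simp
    simp only [hmem']
    clear hmem hmem'
    rcases hvp : c v p with _ | _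
    · match A, hA, hnd, hv' with
      | [], hA, hnd, hv' => exact ⟨v, [], p :: B, by grind, by grind, by simp, by grind⟩
      | a :: A, hA, hnd, hv' =>
        rcases hva : c v a with _ | _
        · exact ⟨a, A, v :: p :: B, by grind, by grind, by grind, by grind⟩
        · exact ⟨v, a :: A, p :: B, by grind, by grind, by grind, by grind⟩
    · match B, hB, hnd, hv' with
      | [], hB, hnd, hv' => exact ⟨v, p :: A, [], by grind, by grind, by grind, by simp⟩
      | b :: B, hB, hnd, hv' =>
        rcases hvb : c v b with _ | _
        · exact ⟨v, p :: A, b :: B, by grind, by grind, by grind, by grind⟩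
        · exact ⟨b, v :: p :: A, B, by grind, by grind, by grind, by grind⟩

theorem exists_long_monoCycle [Fintype V] {c : V → V → Bool} (hsymm : ∀ u v, c u v = c v u) {n : ℕ}
    (hn : 3 ≤ n) (hV : Fintype.card V = 2 * n) : ∃ m col, n ≤ m ∧ HasMonoCycle c col m := by
  classical
  have : Nonempty V := Fintype.card_pos_iff.1 (by omega)
  obtain ⟨p, A, B, hnd, hmem, hA, hB⟩ :=
    exists_two_colored_path hsymm (Finset.univ_nonempty (α := V))
  set L := A.reverse ++ p :: B with hL
  have hlen : L.length = 2 * n := by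
    rw [← hV, ← Finset.card_univ, ← List.toFinset_card_of_nodup hnd]
    congr 1; ext v; simp [hmem]
  have hlen' : A.length + B.length + 1 = 2 * n := by
    rw [← hlen, hL]; simp; omega
  obtain ⟨f, hf, hfL⟩ := exists_periodic_extension (m := 2 * n) (by omega) (fun i => L.getD i p)
    (by
      intro i j hi hj h
      simp only [List.getD_eq_getElem?_getD] at h
      rw [List.getElem?_eq_getElem (by omega), List.getElem?_eq_getElem (by omega)] at h
      exact (hnd.getElem_inj_iff).1 (by simpa using h))
  have hfL' : ∀ (i : ℕ) (hi : i < L.length), f i = L[i] := by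
    intro i hi
    rw [hfL i (by omega)]
    simp [hi]
  rw [List.isChain_iff_getElem] at hA hB
  have h1 : ∀ i : ℤ, 0 ≤ i → i < A.length → c (f i) (f (i + 1)) = true := by
    intro i hi hiA
    lift i to ℕ using hi
    have h := hA (A.length - 1 - i) (by simp; omega)
    rw [← Nat.cast_add_one, hfL' _ (by omega), hfL' _ (by omega), hsymm]
    convert h using 2 <;> grind
  have h2 : ∀ i : ℤ, A.length ≤ i → i + 1 < (2 * n : ℕ) → c (f i) (f (i + 1)) = false := by
    intro i hi hiA
    lift i to ℕ using by omega
    have h := hB (i - A.length) (by simp; omega)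
    rw [← Nat.cast_add_one, hfL' _ (by omega), hfL' _ (by omega)]
    convert h using 2 <;> grind
  have per : ∀ i j, ((2 * n : ℕ) : ℤ) ∣ i - j → f i = f j := fun i j => (hf i j).2
  -- the closing edge extends one of the two arcs
  obtain ⟨t, e, he, h3, h4⟩ : ∃ (t : ℤ) (e : ℕ), e ≤ 2 * n ∧
      (∀ i : ℤ, 0 ≤ i → i < e → c (f (i + t)) (f (i + 1 + t)) = true) ∧
      (∀ i : ℤ, e ≤ i → i < (2 * n : ℕ) → c (f (i + t)) (f (i + 1 + t)) = false) := by
    rcases hcl : c (f ((2 * n : ℕ) - 1)) (f 0) with _ | _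
    · refine ⟨0, A.length, by omega, ?_, ?_⟩
      · simpa using h1
      · intro i hi hi'
        by_cases h : i + 1 < (2 * n : ℕ)
        · simpa using h2 i hi h
        · rw [per (i + 1 + 0) 0 ⟨1, by omega⟩, ← hcl]
          congr 2; omega
    · refine ⟨-1, A.length + 1, by omega, ?_, ?_⟩
      · intro i hi hi'
        rcases hi.eq_or_lt with rfl | hi
        · rw [per (0 + -1) ((2 * n : ℕ) - 1) ⟨-1, by omega⟩]
          simpa using hcl
        · convert h1 (i - 1) (by omega) (by omega) using 3 <;> omega
      · intro i hi hi'
        convert h2 (i - 1) (by omega) (by omega) using 3 <;> omega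
  by_cases hne : n ≤ e
  · exact hasMonoCycle_of_two_arcs hsymm hn (f := fun i => f (i + t)) (col := true)
      (fun i j => by rw [hf]; congr! 1; ring) hne he h3 h4
  · refine hasMonoCycle_of_two_arcs hsymm hn (f := fun i => f (i + e + t)) (col := false)
      (e := 2 * n - e) (fun i j => by rw [hf]; congr! 1; ring) (by omega) (by omega) ?_ ?_
    · intro i hi hi'
      convert h4 (i + e) (by omega) (by omega) using 3; ring
    · intro i hi hi'
      rw [Bool.not_false, ← h3 (i + e - (2 * n : ℕ)) (by omega) (by omega)]
      congr 1
      · exact per _ _ ⟨1, by ring⟩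
      · exact per _ _ ⟨1, by ring⟩

/-- A path with `m` vertices from `x` to `y` inside `S`, all of whose edges have colour `col`. -/
inductive MonoPath [DecidableEq V] (c : V → V → Bool) (col : Bool) : Finset V → ℕ → V → V → Prop
  | single {S : Finset V} {x : V} (hx : x ∈ S) : MonoPath c col S 1 x x
  | cons {S : Finset V} {m : ℕ} {x y z : V} (hx : x ∈ S) (hxy : c x y = col)
      (h : MonoPath c col (S.erase x) m y z) : MonoPath c col S (m + 1) x z

namespace MonoPath

variable [DecidableEq V] {c : V → V → Bool} {col : Bool} {S T : Finset V} {m k : ℕ} {x y z w : V}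

theorem mono (h : MonoPath c col S m x y) (hST : S ⊆ T) : MonoPath c col T m x y := by
  induction h generalizing T with
  | single hx => exact single (hST hx)
  | cons hx hxy _ ih => exact cons (hST hx) hxy (ih (Finset.erase_subset_erase _ hST))

theorem append (h : MonoPath c col S m x y) (hST : Disjoint S T) (hyz : c y z = col)
    (h' : MonoPath c col T k z w) : MonoPath c col (S ∪ T) (m + k) x w := by
  induction h with
  | @single S x hx =>
    rw [add_comm]
    refine cons (Finset.mem_union_left _ hx) hyz (h'.mono fun v hv => ?_)
    have := Finset.disjoint_left.1 hST hx
    grind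
  | @cons S m x y' y hx hxy _ ih =>
    rw [add_right_comm]
    refine cons (Finset.mem_union_left _ hx) hxy
      ((ih (hST.mono_left (Finset.erase_subset _ _)) hyz).mono fun v hv => ?_)
    have := Finset.disjoint_left.1 hST hx
    grind

theorem exists_nat (h : MonoPath c col S m x y) :
    ∃ g : ℕ → V, (∀ i j, i < m → j < m → g i = g j → i = j) ∧ (∀ i, i < m → g i ∈ S) ∧
      (∀ i, i + 1 < m → c (g i) (g (i + 1)) = col) ∧ g 0 = x ∧ g (m - 1) = y ∧ 0 < m := by
  induction h with
  | @single S x hx => exact ⟨fun _ => x, by omega, by simp [hx], by simp, rfl, rfl, one_pos⟩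
  | @cons S m x y z hx hxy _ ih =>
    obtain ⟨g, h1, h2, h3, h4, h5, h6⟩ := ih
    refine ⟨fun i => if i = 0 then x else g (i - 1), ?_, ?_, ?_, rfl, ?_, by omega⟩
    · intro i j hi hj hij
      have := h1 (i - 1) (j - 1)
      have := h2 (i - 1)
      have := h2 (j - 1)
      grind
    · intro i hi
      have := h2 (i - 1)
      grind
    · intro i hi
      have := h3 (i - 1)
      grind
    · grind

theorem hasMonoCycle (h : MonoPath c col S m x y) (hyx : c y x = col) : HasMonoCycle c col m := by
  obtain ⟨g, h1, h2, h3, rfl, rfl, h6⟩ := h.exists_nat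
  exact hasMonoCycle_of_nat h6 g h1 h3 hyx

theorem of_clique (hS : ∀ u ∈ S, ∀ v ∈ S, u ≠ v → c u v = col) (hx : x ∈ S) (hy : y ∈ S)
    (hxy : x ≠ y) (hm : 2 ≤ m) (hmS : m ≤ S.card) : MonoPath c col S m x y := by
  induction m, hm using Nat.le_induction generalizing S x with
  | base => exact cons hx (hS x hx y hy hxy) (single (by grind))
  | succ m hm ih =>
    obtain ⟨z, hz, hzy⟩ : ∃ z ∈ S.erase x, z ≠ y :=
      Finset.exists_mem_ne (by rw [Finset.card_erase_of_mem hx]; omega) y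
    have := Finset.card_erase_of_mem hx
    exact cons hx (hS x hx z (by grind) (by grind))
      (ih (fun u hu v hv => hS u (Finset.mem_of_mem_erase hu) v (Finset.mem_of_mem_erase hv))
        hz (by grind) hzy (by omega))

theorem of_bipartite (hsymm : ∀ u v, c u v = c v u) {A B : Finset V} (hAB : Disjoint A B)
    (h : ∀ a ∈ A, ∀ b ∈ B, c a b = col) (hx : x ∈ A) (hy : y ∈ B) (hm : 1 ≤ m)
    (hA : m ≤ A.card) (hB : m ≤ B.card) : MonoPath c col (A ∪ B) (2 * m) x y := by
  induction m, hm using Nat.le_induction generalizing A B x with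
  | base =>
    have := Finset.disjoint_left.1 hAB hx
    exact cons (Finset.mem_union_left _ hx) (h x hx y hy) (single (by grind))
  | succ m hm ih =>
    obtain ⟨b, hb, hby⟩ : ∃ b ∈ B, b ≠ y := Finset.exists_mem_ne (by omega) y
    obtain ⟨a, ha, hax⟩ : ∃ a ∈ A, a ≠ x := Finset.exists_mem_ne (by omega) x
    have h1 := Finset.disjoint_left.1 hAB hx
    have h2 := Finset.disjoint_right.1 hAB hb
    have h3 := Finset.card_erase_of_mem hx
    have h4 := Finset.card_erase_of_mem hb
    have := ih (A := A.erase x) (B := B.erase b) (x := a)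
      (hAB.mono (Finset.erase_subset _ _) (Finset.erase_subset _ _))
      (fun a ha b hb => h a (Finset.mem_of_mem_erase ha) b (Finset.mem_of_mem_erase hb))
      (by grind) (by grind) (by omega) (by omega)
    exact cons (Finset.mem_union_left _ hx) (h x hx b hb) (cons (by grind)
      ((hsymm _ _).trans (h a ha b hb)) (this.mono fun v hv => by grind))

end MonoPath

section Cliques

variable [DecidableEq V] {c : V → V → Bool} {col : Bool}

theorem exists_even_cycle_of_bipartite (hsymm : ∀ u v, c u v = c v u) {A B : Finset V}
    (hAB : Disjoint A B) (h : ∀ a ∈ A, ∀ b ∈ B, c a b = col) {m : ℕ} (hm : 1 ≤ m)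
    (hA : m ≤ A.card) (hB : m ≤ B.card) : HasMonoCycle c col (2 * m) := by
  obtain ⟨a, ha⟩ := Finset.card_pos.1 (by omega : 0 < A.card)
  obtain ⟨b, hb⟩ := Finset.card_pos.1 (by omega : 0 < B.card)
  exact (MonoPath.of_bipartite hsymm hAB h ha hb hm hA hB).hasMonoCycle
    ((hsymm _ _).trans (h a ha b hb))

theorem exists_odd_cycle_of_bipartite (hsymm : ∀ u v, c u v = c v u) {A B : Finset V}
    (hAB : Disjoint A B) (h : ∀ a ∈ A, ∀ b ∈ B, c a b = col) {m : ℕ} (hm : 1 ≤ m)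
    (hA : m + 1 ≤ A.card) (hB : m ≤ B.card) {x y : V} (hx : x ∈ A) (hy : y ∈ A) (hne : x ≠ y)
    (hxy : c x y = col) : HasMonoCycle c col (2 * m + 1) := by
  obtain ⟨b, hb⟩ := Finset.card_pos.1 (by omega : 0 < B.card)
  have hxB := Finset.disjoint_left.1 hAB hx
  have h3 := Finset.card_erase_of_mem hx
  exact (MonoPath.cons (Finset.mem_union_left B hx) hxy
    ((MonoPath.of_bipartite hsymm (A := A.erase x) (x := y)
      (hAB.mono_left (Finset.erase_subset _ _))
      (fun a ha b hb => h a (Finset.mem_of_mem_erase ha) b hb)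
      (by grind) hb hm (by omega) hB).mono (fun v hv => by grind))).hasMonoCycle
    ((hsymm _ _).trans (h x hx b hb))

theorem star_of_no_disjoint_pair {P : V → V → Prop} {A B : Finset V} (hA : A.Nonempty)
    (h : ∀ a ∈ A, ∀ b ∈ B, ∀ a' ∈ A, ∀ b' ∈ B, P a b → P a' b' → a = a' ∨ b = b') :
    (∃ z ∈ A, ∀ a ∈ A.erase z, ∀ b ∈ B, ¬ P a b) ∨
      ∃ z ∈ B, ∀ a ∈ A, ∀ b ∈ B.erase z, ¬ P a b := by
  by_cases hP : ∃ a ∈ A, ∃ b ∈ B, P a b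
  · obtain ⟨a0, ha0, b0, hb0, h0⟩ := hP
    by_cases h1 : ∃ b ∈ B, b ≠ b0 ∧ P a0 b
    · obtain ⟨b1, hb1, hne, h1⟩ := h1
      refine Or.inl ⟨a0, ha0, fun a ha b hb hab => ?_⟩
      rw [Finset.mem_erase] at ha
      have := h _ ha0 _ hb0 _ ha.2 _ hb h0 hab
      have := h _ ha0 _ hb1 _ ha.2 _ hb h1 hab
      grind
    · refine Or.inr ⟨b0, hb0, fun a ha b hb hab => ?_⟩
      rw [Finset.mem_erase] at hb
      have := h _ ha0 _ hb0 _ ha _ hb.2 h0 hab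
      grind
  · obtain ⟨z, hz⟩ := hA
    exact Or.inl ⟨z, hz, fun a ha b hb hab => hP ⟨a, Finset.mem_of_mem_erase ha, b, hb, hab⟩⟩

theorem exists_cycle_of_two_cliques (hsymm : ∀ u v, c u v = c v u) {A B : Finset V}
    (hAB : Disjoint A B) (hA : ∀ u ∈ A, ∀ v ∈ A, u ≠ v → c u v = col)
    (hB : ∀ u ∈ B, ∀ v ∈ B, u ≠ v → c u v = col) {l n : ℕ} (hn : 4 ≤ n) (hnl : n ≤ 2 * l)
    (hAl : l ≤ A.card) (hBl : l ≤ B.card) {a a' b b' : V} (ha : a ∈ A) (ha' : a' ∈ A) (hb : b ∈ B)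
    (hb' : b' ∈ B) (haa : a ≠ a') (hbb : b ≠ b') (hab : c a b = col) (hab' : c a' b' = col) :
    HasMonoCycle c col n := by
  have h1 := MonoPath.of_clique (m := n / 2) hA ha' ha haa.symm (by omega) (by omega)
  have h2 := MonoPath.of_clique (m := n - n / 2) hB hb hb' hbb (by omega) (by omega)
  have h3 := (h1.append hAB hab h2).hasMonoCycle ((hsymm _ _).trans hab')
  rwa [Nat.add_sub_cancel' (by omega)] at h3

end Cliques

section Reduction

variable [DecidableEq V] {c : V → V → Bool} {col : Bool}

theorem exists_odd_cycle_of_crossing_edges (hsymm : ∀ u v, c u v = c v u) {A B : Finset V}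
    (hAB : Disjoint A B) (hcross : ∀ a ∈ A, ∀ b ∈ B, c a b = col) {t t' b b' : V} (htt : t ≠ t')
    (hbb : b ≠ b') (htA : t ∉ A) (htB : t ∉ B) (htA' : t' ∉ A) (htB' : t' ∉ B) (hb : b ∈ B)
    (hb' : b' ∈ B) (ht : c t t' = col) (htb : c t b = col) (htb' : c t' b' = col) {m : ℕ}
    (hm : 1 ≤ m) (hA : m ≤ A.card) (hB : m + 1 ≤ B.card) : HasMonoCycle c col (2 * m + 3) := by
  obtain ⟨a, ha⟩ := Finset.card_pos.1 (by omega : 0 < A.card)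
  have hbA := Finset.disjoint_right.1 hAB hb'
  have hp := MonoPath.of_bipartite (c := c) (m := m) hsymm
    (hAB.mono_right (Finset.erase_subset b' _))
    (fun a ha b hb => hcross a ha b (Finset.mem_of_mem_erase hb)) ha
    (Finset.mem_erase.2 ⟨hbb, hb⟩) hm hA (by rw [Finset.card_erase_of_mem hb']; omega)
  exact (MonoPath.cons (S := insert t (insert t' (A ∪ B))) (x := t) (y := t') (by simp) ht
    (.cons (y := b') (by grind) htb' (.cons (by grind) ((hsymm _ _).trans (hcross a ha b' hb'))
    (hp.mono fun v hv => by grind)))).hasMonoCycle ((hsymm _ _).trans htb)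

theorem exists_odd_cycle_of_cliques [Fintype V] (hsymm : ∀ u v, c u v = c v u) {A B : Finset V}
    (hAB : Disjoint A B) (hA : ∀ u ∈ A, ∀ v ∈ A, u ≠ v → c u v = col)
    (hB : ∀ u ∈ B, ∀ v ∈ B, u ≠ v → c u v = col) (hcross : ∀ a ∈ A, ∀ b ∈ B, c a b = !col)
    {h : ℕ} (hh : 2 ≤ h) (hV : Fintype.card V = 2 * (2 * h + 1)) (hAh : A.card = h)
    (hBh : B.card = h + 1) : ∃ col', HasMonoCycle c col' (2 * h + 1) := by
  by_contra! hno
  have hw : ∀ w, w ∉ A ∪ B → (∀ a ∈ A, c w a = col) ∨ ∀ b ∈ B, c w b = col := by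
    intro w hwAB
    by_contra! hcon
    obtain ⟨⟨a, ha, hwa⟩, b, hb, hwb⟩ := hcon
    rw [← Bool.eq_not] at hwa hwb
    refine hno (!col) ((MonoPath.cons (S := insert w (A ∪ B)) (Finset.mem_insert_self _ _) hwa
      ?_).hasMonoCycle ((hsymm b w).trans hwb))
    rw [Finset.erase_insert hwAB]
    exact MonoPath.of_bipartite hsymm hAB hcross ha hb (by omega) (by omega) (by omega)
  set TA := (A ∪ B)ᶜ.filter (fun w => ∀ a ∈ A, c w a = col) with hTA
  set TB := (A ∪ B)ᶜ.filter (fun w => ∀ b ∈ B, c w b = col) with hTB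
  have hcard : 2 * h + 1 ≤ TA.card + TB.card := by
    have h1 : (A ∪ B)ᶜ ⊆ TA ∪ TB := by
      intro w hw'
      rw [Finset.mem_union, hTA, hTB, Finset.mem_filter, Finset.mem_filter]
      rcases hw w (Finset.mem_compl.1 hw') with h | h
      · exact Or.inl ⟨hw', h⟩
      · exact Or.inr ⟨hw', h⟩
    have h2 := (Finset.card_le_card h1).trans (Finset.card_union_le _ _)
    rw [Finset.card_compl, Finset.card_union_of_disjoint hAB] at h2
    omega
  have hA2 : ∃ x ∈ A, ∃ y ∈ A, x ≠ y := by
    obtain ⟨x, hx, y, hy, hxy⟩ := Finset.one_lt_card.1 (by omega : 1 < A.card)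
    exact ⟨x, hx, y, hy, hxy⟩
  have hB2 : ∃ x ∈ B, ∃ y ∈ B, x ≠ y := by
    obtain ⟨x, hx, y, hy, hxy⟩ := Finset.one_lt_card.1 (by omega : 1 < B.card)
    exact ⟨x, hx, y, hy, hxy⟩
  obtain ⟨xa, hxa, ya, hya, hxya⟩ := hA2
  obtain ⟨xb, hxb, yb, hyb, hxyb⟩ := hB2
  have hTAd : ∀ w ∈ TA, w ∉ A ∧ w ∉ B ∧ ∀ a ∈ A, c w a = col := by
    intro w hw'
    simp only [hTA, Finset.mem_filter, Finset.mem_compl, Finset.mem_union] at hw'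
    tauto
  have hTBd : ∀ w ∈ TB, w ∉ A ∧ w ∉ B ∧ ∀ b ∈ B, c w b = col := by
    intro w hw'
    simp only [hTB, Finset.mem_filter, Finset.mem_compl, Finset.mem_union] at hw'
    tauto
  clear_value TA TB
  by_cases hTBh : h + 1 ≤ TB.card
  · exact hno col (exists_odd_cycle_of_bipartite hsymm
      (Finset.disjoint_right.2 fun w hw' => (hTBd w hw').2.1)
      (fun b hb w hw' => (hsymm _ _).trans ((hTBd w hw').2.2 b hb)) (by omega) (by omega)
      (by omega) hxb hyb hxyb (hB _ hxb _ hyb hxyb))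
  have hTAh : h + 1 ≤ TA.card := by omega
  have hdA : Disjoint A TA := Finset.disjoint_right.2 fun w hw' => (hTAd w hw').1
  have hdB : Disjoint B TA := Finset.disjoint_right.2 fun w hw' => (hTAd w hw').2.1
  have hTblue : ∀ u ∈ TA, ∀ v ∈ TA, u ≠ v → c u v = !col := by
    intro u hu v hv huv
    rw [Bool.eq_not]
    intro hc
    exact hno col (exists_odd_cycle_of_bipartite hsymm hdA.symm
      (fun w hw' => (hTAd w hw').2.2) (by omega) (by omega) (by omega) hu hv huv hc)
  rcases star_of_no_disjoint_pair (P := fun t b => c t b = !col) (A := TA) (B := B)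
    (Finset.card_pos.1 (by omega)) (by
      intro t ht b hb t' ht' b' hb' htb htb'
      by_contra! hne
      have hp := exists_odd_cycle_of_crossing_edges (m := h - 1) hsymm hAB hcross hne.1 hne.2
        (hTAd t ht).1 (hTAd t ht).2.1 (hTAd t' ht').1 (hTAd t' ht').2.1 hb hb'
        (hTblue t ht t' ht' hne.1) htb htb' (by omega) (by omega) (by omega)
      rw [show 2 * (h - 1) + 3 = 2 * h + 1 by omega] at hp
      exact hno _ hp) with ⟨z, hz, hzred⟩ | ⟨z, hz, hzred⟩
  · refine hno col (exists_odd_cycle_of_bipartite hsymm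
      (hdB.mono_right (Finset.erase_subset z _)) (fun b hb t ht => ?_) (by omega) (by omega)
      (by rw [Finset.card_erase_of_mem hz]; omega) hxb hyb hxyb (hB _ hxb _ hyb hxyb))
    have := hzred t ht b hb
    rw [hsymm]
    simpa using this
  · refine hno col (exists_odd_cycle_of_bipartite hsymm (A := A ∪ B.erase z) (B := TA) ?_ ?_
      (by omega) ?_ (by omega) (Finset.mem_union_left _ hxa) (Finset.mem_union_left _ hya) hxya
      (hA _ hxa _ hya hxya))
    · exact Finset.disjoint_union_left.2 ⟨hdA, hdB.mono_left (Finset.erase_subset z _)⟩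
    · intro d hd t ht
      rw [hsymm]
      rcases Finset.mem_union.1 hd with hd | hd
      · exact (hTAd t ht).2.2 d hd
      · have := hzred t ht d hd
        simpa using this
    · rw [Finset.card_union_of_disjoint (hAB.mono_right (Finset.erase_subset z _)),
        Finset.card_erase_of_mem hz]
      omega

theorem exists_cycle_of_separated_cliques [Fintype V] (hsymm : ∀ u v, c u v = c v u)
    {A B : Finset V} (hAB : Disjoint A B) (hA : ∀ u ∈ A, ∀ v ∈ A, u ≠ v → c u v = col)
    (hB : ∀ u ∈ B, ∀ v ∈ B, u ≠ v → c u v = col) (hcross : ∀ a ∈ A, ∀ b ∈ B, c a b = !col)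
    {n : ℕ} (hn : 4 ≤ n) (hV : Fintype.card V = 2 * n) (hAn : n ≤ 2 * A.card + 1)
    (hBn : n + 1 ≤ 2 * B.card) : ∃ col', HasMonoCycle c col' n := by
  obtain ⟨h, rfl | rfl⟩ := n.even_or_odd'
  · exact ⟨!col, exists_even_cycle_of_bipartite hsymm hAB hcross (by omega) (by omega) (by omega)⟩
  · obtain ⟨A', hA', hA'h⟩ := Finset.exists_subset_card_eq (by omega : h ≤ A.card)
    obtain ⟨B', hB', hB'h⟩ := Finset.exists_subset_card_eq (by omega : h + 1 ≤ B.card)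
    exact exists_odd_cycle_of_cliques hsymm (hAB.mono hA' hB')
      (fun u hu v hv => hA u (hA' hu) v (hA' hv)) (fun u hu v hv => hB u (hB' hu) v (hB' hv))
      (fun a ha b hb => hcross a (hA' ha) b (hB' hb)) (by omega) hV hA'h hB'h

theorem exists_cycle_of_cliques [Fintype V] (hsymm : ∀ u v, c u v = c v u)
    {A B : Finset V} (hAB : Disjoint A B) (hA : ∀ u ∈ A, ∀ v ∈ A, u ≠ v → c u v = col)
    (hB : ∀ u ∈ B, ∀ v ∈ B, u ≠ v → c u v = col) {n : ℕ} (hn : 4 ≤ n)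
    (hV : Fintype.card V = 2 * n) (hAn : n + 1 ≤ 2 * A.card) (hBn : n + 1 ≤ 2 * B.card) :
    ∃ col', HasMonoCycle c col' n := by
  by_contra! hno
  rcases star_of_no_disjoint_pair (P := fun a b => c a b = col) (A := A) (B := B)
    (Finset.card_pos.1 (by omega)) (by
      intro a ha b hb a' ha' b' hb' hab hab'
      by_contra! hne
      exact hno col (exists_cycle_of_two_cliques hsymm hAB hA hB (l := (n + 1) / 2) hn (by omega)
        (by omega) (by omega) ha ha' hb hb' hne.1 hne.2 hab hab')) with
    ⟨z, hz, hzred⟩ | ⟨z, hz, hzred⟩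
  · obtain ⟨col', h⟩ := exists_cycle_of_separated_cliques hsymm
      (hAB.mono_left (Finset.erase_subset z A))
      (fun u hu v hv => hA u (Finset.mem_of_mem_erase hu) v (Finset.mem_of_mem_erase hv)) hB
      (fun a ha b hb => Bool.eq_not.2 (hzred a ha b hb)) hn hV
      (by rw [Finset.card_erase_of_mem hz]; omega) hBn
    exact hno _ h
  · obtain ⟨col', h⟩ := exists_cycle_of_separated_cliques hsymm
      (hAB.symm.mono_left (Finset.erase_subset z B))
      (fun u hu v hv => hB u (Finset.mem_of_mem_erase hu) v (Finset.mem_of_mem_erase hv)) hA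
      (fun b hb a ha => (hsymm _ _).trans (Bool.eq_not.2 (hzred a ha b hb))) hn hV
      (by rw [Finset.card_erase_of_mem hz]; omega) hAn
    exact hno _ h

theorem IsMonoCycle.exists_cycle_of_even [Fintype V] (hsymm : ∀ u v, c u v = c v u) {l n : ℕ}
    (hn : 4 ≤ n) (hV : Fintype.card V = 2 * n) (hnl : n < 2 * l) {f : ℤ → V}
    (hf : IsMonoCycle c col (2 * l) f) (hno : ∀ col', ¬ HasMonoCycle c col' (2 * l - 1)) :
    ∃ col', HasMonoCycle c col' n := by
  have hinj : ∀ t : ℤ, Function.Injective fun i : Fin l => f (2 * (i : ℕ) + t) := by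
    intro t i j hij
    have hd := (hf.1 _ _).1 hij
    have := Int.eq_zero_of_abs_lt_dvd hd (by rw [abs_lt]; omega)
    omega
  have hcl : ∀ t : ℤ, ∀ u ∈ Finset.univ.image (fun i : Fin l => f (2 * (i : ℕ) + t)),
      ∀ v ∈ Finset.univ.image (fun i : Fin l => f (2 * (i : ℕ) + t)), u ≠ v → c u v = !col := by
    intro t u hu v hv huv
    simp only [Finset.mem_image, Finset.mem_univ, true_and] at hu hv
    obtain ⟨i, rfl⟩ := hu
    obtain ⟨j, rfl⟩ := hv
    have hij : (i : ℕ) ≠ j := fun h => huv (by rw [h])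
    rcases lt_or_gt_of_ne hij with h | h
    · convert hf.even_chord hsymm (by omega) hno (2 * (i : ℕ) + t) (j - i) (by omega) (by omega)
        using 3
      omega
    · rw [hsymm]
      convert hf.even_chord hsymm (by omega) hno (2 * (j : ℕ) + t) (i - j) (by omega) (by omega)
        using 3
      omega
  refine exists_cycle_of_cliques hsymm ?_ (hcl 0) (hcl 1) hn hV ?_ ?_
  · rw [Finset.disjoint_left]
    intro u hu hv
    simp only [Finset.mem_image, Finset.mem_univ, true_and] at hu hv
    obtain ⟨i, rfl⟩ := hu
    obtain ⟨j, hj⟩ := hv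
    have hd := (hf.1 _ _).1 hj
    have h2 : (2 : ℤ) ∣ ((2 * l : ℕ) : ℤ) := ⟨l, by push_cast; ring⟩
    have := h2.trans hd
    omega
  · rw [Finset.card_image_of_injective _ (hinj 0), Finset.card_univ, Fintype.card_fin]; omega
  · rw [Finset.card_image_of_injective _ (hinj 1), Finset.card_univ, Fintype.card_fin]; omega

theorem IsMonoCycle.exists_four_cycle_of_five [Fintype V] (hsymm : ∀ u v, c u v = c v u)
    (hV : 6 ≤ Fintype.card V) {f : ℤ → V} (hf : IsMonoCycle c col 5 f) :
    ∃ col', HasMonoCycle c col' 4 := by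
  by_contra! hno
  have two : ∀ i, c (f i) (f (i + 2)) = !col := fun i => by
    by_contra h2
    refine hno col (hf.hasMonoCycle_pred hsymm (i - 1) 1 (by omega) (by omega) ?_ ?_)
    · exact_mod_cast hf.2 (i - 1)
    · convert (by rwa [Bool.eq_not, not_not] at h2 : c (f i) (f (i + 2)) = col) using 3 <;> push_cast <;> ring
  obtain ⟨w, hw⟩ : ∃ w, ∀ i, f i ≠ w := by
    have hcard : ((Finset.range 5).image fun i : ℕ => f i).card < Fintype.card V :=
      Finset.card_image_le.trans_lt (by rw [Finset.card_range]; omega)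
    obtain ⟨w, hw⟩ : ∃ w, w ∉ (Finset.range 5).image fun i : ℕ => f i := by
      by_contra! h
      rw [Finset.eq_univ_iff_forall.2 h, Finset.card_univ] at hcard
      omega
    refine ⟨w, fun i hi => hw ?_⟩
    obtain ⟨k, hk, hd⟩ := exists_nat_rep (m := 5) (by omega) i
    exact Finset.mem_image.2 ⟨k, Finset.mem_range.2 hk, by rw [← hi, (hf.1 _ _).2 hd]⟩
  have key : ∀ (i s : ℤ) (col' : Bool), ¬ (5 : ℤ) ∣ s → ¬ (5 : ℤ) ∣ 2 * s →
      (∀ j, c (f j) (f (j + s)) = col') → c w (f i) = col' → c w (f (i + 2 * s)) = col' → False := by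
    intro i s col' h1 h2 h3 h4 h5
    have e1 : f i ≠ f (i + s) := fun h => h1 (by
      have := (hf.1 _ _).1 h; omega)
    have e2 : f i ≠ f (i + 2 * s) := fun h => h2 (by
      have := (hf.1 _ _).1 h; omega)
    have e3 : f (i + s) ≠ f (i + 2 * s) := fun h => h1 (by
      have := (hf.1 _ _).1 h; omega)
    have h6 := h3 (i + s)
    rw [show i + s + s = i + 2 * s by ring] at h6
    refine hno col' (MonoPath.hasMonoCycle (S := Finset.univ) (.cons (by simp) h4
      (.cons (by grind) (h3 i) (.cons (by grind) h6 (.single (by grind)))))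
      ((hsymm _ _).trans h5))
  have k1 : ∀ i j, (5 : ℤ) ∣ j - (i + 2) → c w (f i) = col → c w (f j) = col → False := by
    intro i j hij h1 h2
    rw [(hf.1 j (i + 2)).2 hij] at h2
    exact key i 1 col (by omega) (by omega) hf.2 h1 h2
  have k2 : ∀ i j, (5 : ℤ) ∣ j - (i + 4) → c w (f i) = !col → c w (f j) = !col → False := by
    intro i j hij h1 h2
    rw [(hf.1 j (i + 4)).2 hij] at h2
    exact key i 2 (!col) (by omega) (by omega) two h1 h2
  have hbool : ∀ col x0 x1 x2 x3 x4 : Bool, (x0 = col → x2 = col → False) →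
      (x1 = col → x3 = col → False) → (x2 = col → x4 = col → False) →
      (x3 = col → x0 = col → False) → (x4 = col → x1 = col → False) →
      (x0 = !col → x4 = !col → False) → (x1 = !col → x0 = !col → False) →
      (x2 = !col → x1 = !col → False) → (x3 = !col → x2 = !col → False) →
      (x4 = !col → x3 = !col → False) → False := by
    intro col x0 x1 x2 x3 x4
    cases col <;> cases x0 <;> cases x1 <;> cases x2 <;> cases x3 <;> cases x4 <;> simp
  exact hbool col _ _ _ _ _ (k1 0 2 (by omega)) (k1 1 3 (by omega)) (k1 2 4 (by omega))
    (k1 3 0 (by omega)) (k1 4 1 (by omega)) (k2 0 4 (by omega)) (k2 1 0 (by omega))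
    (k2 2 1 (by omega)) (k2 3 2 (by omega)) (k2 4 3 (by omega))

theorem exists_monoTriangle [Fintype V] (hsymm : ∀ u v, c u v = c v u)
    (hV : 6 ≤ Fintype.card V) : ∃ col', HasMonoCycle c col' 3 := by
  by_contra! hno
  obtain ⟨g⟩ := Function.Embedding.nonempty_of_card_le (α := Fin 6) (β := V) (by simpa using hV)
  have key : ∀ i j k, i ≠ j → j ≠ k → i ≠ k → ∀ col', c (g i) (g j) = col' → c (g j) (g k) = col' →
      c (g i) (g k) = col' → False := by
    intro i j k hij hjk hik col' h1 h2 h3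
    have e1 := g.injective.ne hij
    have e2 := g.injective.ne hjk
    have e3 := g.injective.ne hik
    exact hno col' (MonoPath.hasMonoCycle (S := Finset.univ) (.cons (by simp) h1
      (.cons (by grind) h2 (.single (by grind)))) ((hsymm _ _).trans h3))
  obtain ⟨T, col', hT, hTc⟩ : ∃ (T : Finset (Fin 6)) (col' : Bool), 3 ≤ T.card ∧
      ∀ i ∈ T, i ≠ 0 ∧ c (g 0) (g i) = col' := by
    have h := Finset.card_filter_add_card_filter_not (s := (Finset.univ : Finset (Fin 6)).erase 0)
      (fun i => c (g 0) (g i) = true)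
    rw [Finset.card_erase_of_mem (Finset.mem_univ _), Finset.card_univ, Fintype.card_fin] at h
    by_cases h3 : 3 ≤ (((Finset.univ : Finset (Fin 6)).erase 0).filter
      (fun i => c (g 0) (g i) = true)).card
    · exact ⟨_, true, h3, by simp⟩
    · exact ⟨((Finset.univ : Finset (Fin 6)).erase 0).filter (fun i => ¬ c (g 0) (g i) = true),
        false, by omega, by simp⟩
  obtain ⟨i, j, k, hi, hj, hk, hij, hik, hjk⟩ := Finset.two_lt_card_iff.1 hT
  obtain ⟨hi0, hi⟩ := hTc i hi
  obtain ⟨hj0, hj⟩ := hTc j hj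
  obtain ⟨hk0, hk⟩ := hTc k hk
  have h1 := key 0 i j hi0.symm hij hj0.symm col' hi
  have h2 := key 0 j k hj0.symm hjk hk0.symm col' hj
  have h3 := key 0 i k hi0.symm hik hk0.symm col' hi
  have h4 := key i j k hij hjk hik (!col')
  exact h4 (Bool.eq_not.2 fun h => h1 h hj) (Bool.eq_not.2 fun h => h2 h hk)
    (Bool.eq_not.2 fun h => h3 h hk)

theorem exists_monoCycle [Fintype V] (hsymm : ∀ u v, c u v = c v u) {n : ℕ} (hn : 3 ≤ n)
    (hV : Fintype.card V = 2 * n) : ∃ col', HasMonoCycle c col' n := by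
  rcases hn.eq_or_lt with rfl | hn4
  · exact exists_monoTriangle hsymm (by omega)
  have hex : ∃ m, n ≤ m ∧ ∃ col', HasMonoCycle c col' m := by
    obtain ⟨m, col', h1, h2⟩ := exists_long_monoCycle hsymm hn hV
    exact ⟨m, h1, col', h2⟩
  classical
  obtain ⟨hnm, col', f, hf⟩ := Nat.find_spec hex
  have hmin := fun k => Nat.find_min hex (m := k)
  generalize Nat.find hex = m at *
  rcases hnm.eq_or_lt with rfl | hnm
  · exact ⟨col', f, hf⟩
  obtain ⟨l, rfl | rfl⟩ := m.even_or_odd'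
  · exact hf.exists_cycle_of_even hsymm hn4 hV hnm
      fun col' h => hmin (2 * l - 1) (by omega) ⟨by omega, col', h⟩
  · by_cases hl : 3 ≤ l
    · exact absurd ⟨by omega, hf.exists_hasMonoCycle_of_odd hsymm hl⟩ (hmin (2 * l) (by omega))
    · obtain rfl : l = 2 := by omega
      obtain rfl : n = 4 := by omega
      exact IsMonoCycle.exists_four_cycle_of_five hsymm (by omega) hf

end Reduction

end MonochromaticCycles

theorem graphArrows_two_mul_cycleGraph {k : ℕ} (hk : 3 ≤ k) :
    GraphArrows (2 * k) (SimpleGraph.cycleGraph k) := by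
  intro c hsymm
  obtain ⟨col, f, hf⟩ := exists_monoCycle hsymm hk (Fintype.card_fin _)
  have hstep : ∀ a b : Fin k, (b - a).val = 1 → c (f (a : ℕ)) (f (b : ℕ)) = col := by
    intro a b hab
    rw [Fin.sub_def] at hab
    have h1 := Nat.div_add_mod (k - a + b) k
    simp only at hab
    rw [hab] at h1
    have he : f (b : ℕ) = f ((a : ℕ) + 1) := by
      refine (hf.1 _ _).2 ⟨((k - a + b) / k : ℕ) - 1, ?_⟩
      have := a.isLt
      rw [mul_sub, ← Nat.cast_mul]
      omega
    rw [he]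
    exact hf.2 _
  refine ⟨fun a => f (a : ℕ), col, fun a b hab => ?_, fun a b hab => ?_⟩
  · have hd := (hf.1 _ _).1 hab
    have := Int.eq_zero_of_abs_lt_dvd hd (by rw [abs_lt]; omega)
    omega
  · rw [SimpleGraph.cycleGraph_adj'] at hab
    rcases hab with hab | hab
    · rw [hsymm]; exact hstep b a hab
    · exact hstep a b hab

/-- For every `k ≥ 3`, the Ramsey number of the cycle `C_k` is at most `2k`. -/
theorem stmt_8 (k : ℕ) (hk : 3 ≤ k) :
    ramseyNumber (SimpleGraph.cycleGraph k) ≤ 2 * k := by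
  exact Nat.sInf_le (graphArrows_two_mul_cycleGraph hk)
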